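/- arXiv:hep-th/9610058 — 3 statements merged into one kernel-verified Lean document; each statement's English description precedes it below -/
import Mathlib

section
/- Let n ≥ 1 and let f : ℂ^n → ℂ be a function that is (complex-)differentiable at a point y ∈ ℂ^n and invariant under all permutations of coordinates: f(x_{σ(1)},…,x_{σ(n)}) = f(x_1,…,x_n) for all x ∈ ℂ^n and all σ in the symmetric group S_n. Let M = {v ∈ ℂ^n : v_i = v_j for all pairs (i,j) with y_i = y_j}. If the derivative of f at y vanishes on M (i.e. y is a critical point of the restriction of f to the affine subspace y + M), then the derivative of f at y is zero, i.e. y is a critical point of f. -/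
/-- If a function is invariant under permuting coordinates by `σ`, then its derivative at a point
fixed by `σ` is invariant under `σ`. -/
theorem fderiv_apply_comp_perm {ι : Type*} [Fintype ι] {f : (ι → ℂ) → ℂ} {y : ι → ℂ}
    (hf : DifferentiableAt ℂ f y) {σ : Equiv.Perm ι} (hfσ : ∀ x, f (x ∘ σ) = f x)
    (hy : y ∘ σ = y) (v : ι → ℂ) : fderiv ℂ f y (v ∘ σ) = fderiv ℂ f y v := by
  let P : (ι → ℂ) →L[ℂ] (ι → ℂ) := ContinuousLinearMap.pi fun i => ContinuousLinearMap.proj (σ i)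
  have hPy : P y = y := hy
  have hcomp : HasFDerivAt (f ∘ P) ((fderiv ℂ f y).comp P) y := by
    refine HasFDerivAt.comp y ?_ P.hasFDerivAt
    rw [hPy]
    exact hf.hasFDerivAt
  have hfP : f ∘ P = f := funext hfσ
  rw [hfP] at hcomp
  exact DFunLike.congr_fun (hcomp.unique hf.hasFDerivAt) v


/-- key assertion in the proof of Lemma 2: let `f : ℂ^n → ℂ` be
differentiable at `y` and invariant under all permutations of coordinates.
Let `M = {v : v_i = v_j whenever y_i = y_j}` (the tangent space of the stratum of
the mirror arrangement through `y`). If the derivative of `f` at `y` vanishes on `M`,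
then the derivative of `f` at `y` is zero, i.e. `y` is a critical point of `f`. -/
theorem stmt7 (n : ℕ) (hn : 1 ≤ n) (f : (Fin n → ℂ) → ℂ) (y : Fin n → ℂ)
    (hdiff : DifferentiableAt ℂ f y)
    (hinv : ∀ (x : Fin n → ℂ) (σ : Equiv.Perm (Fin n)), f (x ∘ σ) = f x)
    (hM : ∀ v : Fin n → ℂ, (∀ i j, y i = y j → v i = v j) → fderiv ℂ f y v = 0) :
    fderiv ℂ f y = 0 := by
  have hswap : ∀ i j, y i = y j →
      fderiv ℂ f y (Pi.single j 1) = fderiv ℂ f y (Pi.single i 1) := by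
    intro i j hij
    have hy : y ∘ Equiv.swap i j = y := by
      ext k
      simp only [Function.comp_apply, Equiv.swap_apply_def]
      split_ifs <;> simp_all
    have hsingle : (Pi.single i 1 : Fin n → ℂ) ∘ Equiv.swap i j = Pi.single j 1 := by
      ext k
      simp only [Function.comp_apply, Equiv.swap_apply_def, Pi.single_apply]
      split_ifs <;> simp_all
    rw [← hsingle]
    exact fderiv_apply_comp_perm hdiff (fun x => hinv x _) hy _
  have hbasis : ∀ k, fderiv ℂ f y (Pi.single k 1) = 0 := by
    intro k
    let S := Finset.univ.filter fun j => y k = y j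
    have hsum : fderiv ℂ f y (∑ j ∈ S, Pi.single j 1) = 0 := by
      apply hM
      intro i j hij
      simp [S, Finset.sum_apply, Pi.single_apply, hij]
    rw [map_sum, Finset.sum_congr rfl fun j hj => hswap k j (Finset.mem_filter.mp hj).2,
      Finset.sum_const, smul_eq_zero] at hsum
    have hk : k ∈ S := by simp [S]
    exact hsum.resolve_left (Finset.card_ne_zero_of_mem hk)
  apply ContinuousLinearMap.coe_injective
  apply (Pi.basisFun ℂ (Fin n)).ext
  simpa using hbasis
end

section
/- Let h ≥ 2 and let z_1, …, z_{h−1} be pairwise distinct complex numbers. Then there exists a monic polynomial g ∈ ℂ[y] of degree h whose coefficient of y^{h−1} is zero, such that g has exactly h−1 distinct critical points p_1, …, p_{h−1} (the roots of g′, all simple, so g″(p_j) ≠ 0 for each j), and the set of critical values {g(p_1), …, g(p_{h−1})} equals {z_1, …, z_{h−1}}. -/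
open Polynomial

namespace MvPolynomial

variable {k σ : Type*} [Field k]

/-- Over an algebraically closed field, the ideal of the origin in affine space has height at least
the dimension of that space. -/
theorem card_le_height_vanishingIdeal_zero [IsAlgClosed k] [Finite σ] :
    (Nat.card σ : ℕ∞) ≤ (vanishingIdeal k {(0 : σ → k)}).height := by
  have hdim : ringKrullDim (MvPolynomial σ k) ≤ ((vanishingIdeal k {(0 : σ → k)}).height : ℕ∞) := by
    rw [ringKrullDim_le_iff_isMaximal_height_le]
    intro m hm
    obtain ⟨x, rfl⟩ := eq_vanishingIdeal_singleton_of_isMaximal k hm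
    let e : MvPolynomial σ k ≃ₐ[k] MvPolynomial σ k :=
      AlgEquiv.ofAlgHom (aeval fun i => X i + C (x i)) (aeval fun i => X i - C (x i))
        (by ext i; simp [← algebraMap_eq]) (by ext i; simp [← algebraMap_eq])
    have hcomp (p : MvPolynomial σ k) : aeval (0 : σ → k) (e p) = aeval x p := by
      have : (aeval (0 : σ → k)).comp e.toAlgHom = aeval x := by ext i; simp [e]
      exact DFunLike.congr_fun this p
    have hm : vanishingIdeal k {x} =
        (vanishingIdeal k {(0 : σ → k)}).comap e.toRingEquiv := by
      ext p
      simp only [Ideal.mem_comap, mem_vanishingIdeal_singleton_iff]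
      exact (hcomp p ▸ Iff.rfl)
    rw [hm, RingEquiv.height_comap]
  rw [ringKrullDim_of_isNoetherianRing, ringKrullDim_eq_zero_of_field, zero_add] at hdim
  exact_mod_cast hdim

/-- Fewer equations than unknowns, all satisfied at the origin, have a solution other than the
origin. -/
theorem exists_ne_zero_forall_eval_eq_zero [IsAlgClosed k] [Finite σ] {ι : Type*} [Finite ι]
    (hcard : Nat.card ι < Nat.card σ) (P : ι → MvPolynomial σ k) (hP : ∀ j, eval 0 (P j) = 0) :
    ∃ x : σ → k, x ≠ 0 ∧ ∀ j, eval x (P j) = 0 := by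
  by_contra! hx
  have hlocus : zeroLocus k (Ideal.span (Set.range P)) = {(0 : σ → k)} := by
    ext x
    simp only [zeroLocus_span, Set.forall_mem_range, aeval_eq_eval, Set.mem_ofPred_eq,
      Set.mem_singleton_iff]
    refine ⟨fun h => ?_, fun h => h ▸ hP⟩
    by_contra hne
    obtain ⟨j, hj⟩ := hx x hne
    exact hj (h j)
  have hrad := vanishingIdeal_zeroLocus_eq_radical (k := k) (K := k) (Ideal.span (Set.range P))
  rw [hlocus] at hrad
  have hmin : vanishingIdeal k {(0 : σ → k)} ∈ (Ideal.span (Set.range P)).minimalPrimes :=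
    ⟨⟨inferInstance, hrad ▸ Ideal.le_radical⟩,
      fun q hq _ => hrad ▸ hq.1.radical_le_iff.2 hq.2⟩
  have hle := card_le_height_vanishingIdeal_zero.trans
    (Ideal.height_le_card_of_mem_minimalPrimes_span (Set.finite_range P) hmin)
  have hrange : (Set.range P).ncard ≤ Nat.card ι := by
    rw [← Set.image_univ, ← Set.ncard_univ]
    exact Set.ncard_image_le
  have : Nat.card σ ≤ (Set.range P).ncard := by exact_mod_cast hle
  omega

end MvPolynomial

namespace Polynomial

variable {k : Type*} [Field k]

/-- The antiderivative of a polynomial which vanishes at the origin. -/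
noncomputable def primitive (q : k[X]) : k[X] :=
  ∑ i ∈ Finset.range (q.natDegree + 1), monomial (i + 1) (q.coeff i / (i + 1))

theorem derivative_primitive [CharZero k] (q : k[X]) : derivative (primitive q) = q := by
  conv_rhs => rw [q.as_sum_range]
  rw [primitive, derivative_sum]
  refine Finset.sum_congr rfl fun i _ => ?_
  have : (i : k) + 1 ≠ 0 := Nat.cast_add_one_ne_zero i
  simp [this]

theorem eval_primitive (q : k[X]) (x : k) : (primitive q).eval x =
    ∑ i ∈ Finset.range (q.natDegree + 1), q.coeff i / (i + 1) * x ^ (i + 1) := by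
  simp [primitive, eval_finsetSum]

theorem natDegree_primitive [CharZero k] {q : k[X]} (hq : q ≠ 0) :
    (primitive q).natDegree = q.natDegree + 1 := by
  have hpos : (primitive q).natDegree ≠ 0 := fun h0 => hq <| by
    rw [← derivative_primitive q]
    exact derivative_of_natDegree_zero h0
  have := natDegree_derivative (primitive q)
  rw [derivative_primitive] at this
  omega

theorem leadingCoeff_primitive [CharZero k] {q : k[X]} (hq : q ≠ 0) :
    (primitive q).leadingCoeff = q.leadingCoeff / (q.natDegree + 1) := by
  have h1 : (q.natDegree : k) + 1 ≠ 0 := Nat.cast_add_one_ne_zero _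
  have := coeff_derivative (primitive q) q.natDegree
  rw [derivative_primitive] at this
  rw [leadingCoeff, leadingCoeff, natDegree_primitive hq, this, mul_div_cancel_right₀ _ h1]

/-- A polynomial vanishing at all its critical points has only one root. -/
theorem card_toFinset_roots_eq_one [CharZero k] [IsAlgClosed k] [DecidableEq k] {f : k[X]}
    (hf : f.natDegree ≠ 0) (h : ∀ x, (derivative f).IsRoot x → f.IsRoot x) :
    f.roots.toFinset.card = 1 := by
  have hf0 : f ≠ 0 := fun h0 => hf (by simp [h0])
  have hd0 : derivative f ≠ 0 := fun h0 => hf (derivative_eq_zero.1 h0)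
  have hsum : ∑ a ∈ f.roots.toFinset, f.roots.count a = f.natDegree := by
    rw [Multiset.toFinset_sum_count_eq, IsAlgClosed.card_roots_eq_natDegree]
  have hsub : ∀ a ∈ (derivative f).roots, a ∈ f.roots.toFinset := fun a ha => by
    rw [Multiset.mem_toFinset, mem_roots hf0]
    exact h a (isRoot_of_mem_roots ha)
  have hsum' : ∑ a ∈ f.roots.toFinset, (derivative f).roots.count a = f.natDegree - 1 := by
    rw [Multiset.sum_count_eq_card hsub, IsAlgClosed.card_roots_eq_natDegree, natDegree_derivative]
  have hcount : ∀ a ∈ f.roots.toFinset, f.roots.count a = (derivative f).roots.count a + 1 := by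
    intro a ha
    rw [Multiset.mem_toFinset] at ha
    have hpos := Multiset.count_pos.2 ha
    rw [count_roots] at hpos
    rw [count_roots, count_roots, derivative_rootMultiplicity_of_root (isRoot_of_mem_roots ha)]
    omega
  rw [Finset.sum_congr rfl hcount, Finset.sum_add_distrib, hsum', Finset.sum_const] at hsum
  simp only [smul_eq_mul, mul_one] at hsum
  omega

/-- If the primitive of `∏ i, (X - p i)` vanishes at every `p i`, then every `p i` vanishes. -/
theorem eq_zero_of_forall_eval_primitive_eq_zero [CharZero k] [IsAlgClosed k] {ι : Type*}
    [Fintype ι] {p : ι → k}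
    (h : ∀ j, (primitive (∏ i, (X - C (p i)))).eval (p j) = 0) : p = 0 := by
  classical
  have hq : (∏ i, (X - C (p i))).Monic := monic_prod_X_sub_C _ _
  set f := primitive (∏ i, (X - C (p i))) with hf
  have hdeg : f.natDegree = _ := natDegree_primitive hq.ne_zero
  have hf0 : f ≠ 0 := fun h0 => by simp [h0] at hdeg
  have hone := card_toFinset_roots_eq_one (f := f) (by omega) fun x hx => by
    rw [hf, derivative_primitive, IsRoot, eval_prod, Finset.prod_eq_zero_iff] at hx
    obtain ⟨i, -, hi⟩ := hx
    rw [eval_sub, eval_X, eval_C, sub_eq_zero] at hi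
    exact hi ▸ h i
  obtain ⟨a, ha⟩ := Finset.card_eq_one.1 hone
  have hroot (x : k) (hx : f.eval x = 0) : x = a := by
    rw [← Finset.mem_singleton, ← ha, Multiset.mem_toFinset, mem_roots hf0]
    exact hx
  ext j
  exact (hroot _ (h j)).trans (hroot 0 (by simp [hf, eval_primitive])).symm

/-- Up to rescaling by some `t ≠ 0`, any prescribed family of values is the family of critical
values of a polynomial. -/
theorem exists_eval_primitive_prod_eq [CharZero k] [IsAlgClosed k] {ι : Type*} [Fintype ι]
    (z : ι → k) (m : ℕ) (hm : m ≠ 0) :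
    ∃ t : k, t ≠ 0 ∧ ∃ p : ι → k,
      ∀ j, (primitive (∏ i, (X - C (p i)))).eval (p j) = z j * t ^ m := by
  let q : (MvPolynomial (Option ι) k)[X] := ∏ i, (X - C (MvPolynomial.X (some i)))
  let P (j : ι) : MvPolynomial (Option ι) k :=
    (∑ l ∈ Finset.range (Fintype.card ι + 1), q.coeff l * MvPolynomial.C ((l + 1 : k)⁻¹) *
      MvPolynomial.X (some j) ^ (l + 1)) -
      MvPolynomial.C (z j) * MvPolynomial.X none ^ m
  have hP (x : Option ι → k) (j : ι) : MvPolynomial.eval x (P j) =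
      (primitive (∏ i, (X - C (x (some i))))).eval (x (some j)) - z j * x none ^ m := by
    have hq : q.map (MvPolynomial.eval x) = ∏ i, (X - C (x (some i))) := by
      simp [q, Polynomial.map_prod]
    simp [P, eval_primitive, ← hq, div_eq_mul_inv]
    simp [hq, natDegree_prod_of_monic, monic_X_sub_C]
  obtain ⟨x, hx0, hx⟩ := MvPolynomial.exists_ne_zero_forall_eval_eq_zero (by simp) P
    fun j => by rw [hP]; simp [hm, eval_primitive]
  simp only [hP, sub_eq_zero] at hx
  refine ⟨x none, fun ht => hx0 ?_, fun i => x (some i), hx⟩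
  have hp := eq_zero_of_forall_eval_primitive_eq_zero (p := fun i => x (some i)) fun j => by
    rw [hx, ht, zero_pow hm, mul_zero]
  ext (_ | i)
  · exact ht
  · exact congrFun hp i

/-- Any finite nonempty family of values is the family of critical values of a monic polynomial
whose critical points sum to zero. -/
theorem exists_monic_derivative_eq_prod [CharZero k] [IsAlgClosed k] {ι : Type*} [Fintype ι]
    [Nonempty ι] (z : ι → k) :
    ∃ (g : k[X]) (r : ι → k), g.Monic ∧ g.natDegree = Fintype.card ι + 1 ∧
      derivative g = C ((Fintype.card ι : k) + 1) * ∏ i, (X - C (r i)) ∧ ∑ i, r i = 0 ∧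
      ∀ j, g.eval (r j) = z j := by
  set n := Fintype.card ι with hn
  have hn0 : (n : k) ≠ 0 := Nat.cast_ne_zero.2 Fintype.card_ne_zero
  have hn1 : (n : k) + 1 ≠ 0 := Nat.cast_add_one_ne_zero n
  obtain ⟨t, ht, p, hp⟩ :=
    exists_eval_primitive_prod_eq (fun j => z j / (n + 1)) (n + 1) n.succ_ne_zero
  set q := ∏ i, (X - C (p i)) with hq
  have hqm : q.Monic := monic_prod_X_sub_C _ _
  have hqn : q.natDegree = n := by simp [hq, natDegree_prod_of_monic, monic_X_sub_C, hn]
  let μ := (∑ i, p i) / n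
  have hlin : (C t * X + C μ).natDegree = 1 := natDegree_linear ht
  have hc : (n + 1) * (t ^ (n + 1))⁻¹ ≠ 0 := mul_ne_zero hn1 (inv_ne_zero (pow_ne_zero _ ht))
  refine ⟨C ((n + 1) * (t ^ (n + 1))⁻¹) * (primitive q).comp (C t * X + C μ),
    fun i => (p i - μ) / t, ?_, ?_, ?_, ?_, fun j => ?_⟩
  · rw [Monic, leadingCoeff_mul, leadingCoeff_comp (by omega), leadingCoeff_C,
      leadingCoeff_primitive hqm.ne_zero, natDegree_primitive hqm.ne_zero, leadingCoeff_linear ht,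
      hqn, hqm.leadingCoeff]
    field_simp
  · rw [natDegree_C_mul hc, natDegree_comp, hlin, natDegree_primitive hqm.ne_zero, hqn, mul_one]
  · have hprod : q.comp (C t * X + C μ) = C (t ^ n) * ∏ i, (X - C ((p i - μ) / t)) := by
      have hfac (i : ι) : C t * X + C μ - C (p i) = C t * (X - C ((p i - μ) / t)) := by
        rw [mul_sub, ← C_mul, mul_div_cancel₀ _ ht, C_sub]
        ring
      simp [hq, prod_comp, hfac, Finset.prod_mul_distrib, hn]
    rw [derivative_C_mul, derivative_comp, derivative_primitive, hprod]
    simp only [derivative_add, derivative_C_mul, derivative_X, derivative_C, mul_one, add_zero]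
    rw [← mul_assoc, ← mul_assoc, ← C_mul, ← C_mul]
    congr 2
    field_simp
    ring
  · rw [← Finset.sum_div, Finset.sum_sub_distrib, Finset.sum_const, Finset.card_univ, ← hn,
      nsmul_eq_mul, mul_div_cancel₀ _ hn0, sub_self, zero_div]
  · have harg : t * ((p j - μ) / t) + μ = p j := by field_simp; ring
    simp only [eval_mul, eval_C, eval_comp, eval_add, eval_X, harg, hp]
    field_simp

end Polynomial

/-- analytic content of Lemma 1, via the Lyashko–Looijenga theorem:
given `h ≥ 2` and pairwise distinct complex numbers `z₁, …, z_{h-1}`, there is a monic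
polynomial `g` of degree `h` with vanishing coefficient of `y^{h-1}`, having exactly
`h-1` distinct critical points `p₁, …, p_{h-1}` (all roots of `g'`, all simple, so
`g''(p_j) ≠ 0`), whose set of critical values `{g(p₁), …, g(p_{h-1})}` equals
`{z₁, …, z_{h-1}}`. -/
theorem stmt9 (h : ℕ) (hh : 2 ≤ h) (z : Fin (h - 1) → ℂ) (hz : Function.Injective z) :
    ∃ g : Polynomial ℂ, g.Monic ∧ g.natDegree = h ∧ g.coeff (h - 1) = 0 ∧
      ∃ p : Fin (h - 1) → ℂ, Function.Injective p ∧
        (∀ j, (derivative g).eval (p j) = 0) ∧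
        (∀ j, (derivative (derivative g)).eval (p j) ≠ 0) ∧
        (∀ w : ℂ, (derivative g).eval w = 0 → ∃ j, w = p j) ∧
        Set.range (fun j => g.eval (p j)) = Set.range z := by
  have : Nonempty (Fin (h - 1)) := ⟨⟨0, by omega⟩⟩
  obtain ⟨g, r, hg, hdeg, hder, hsum, hval⟩ := exists_monic_derivative_eq_prod z
  rw [Fintype.card_fin] at hdeg hder
  have hc : ((h - 1 : ℕ) : ℂ) + 1 ≠ 0 := Nat.cast_add_one_ne_zero _
  have hr : Function.Injective r := fun i j hij => hz <| by rw [← hval, ← hval, hij]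
  have hroot (w : ℂ) : (derivative g).eval w = 0 ↔ ∃ j, w = r j := by
    simp [hder, eval_prod, Finset.prod_eq_zero_iff, sub_eq_zero, hc]
  refine ⟨g, hg, by omega, ?_, r, hr, fun j => (hroot _).2 ⟨j, rfl⟩, fun j => ?_,
    fun w => (hroot w).1, by simp only [hval]⟩
  · have hcoeff := coeff_derivative g (h - 2)
    have hpred := prod_X_sub_C_coeff_card_pred Finset.univ r (by rw [Finset.card_fin]; omega)
    rw [Finset.card_fin, hsum, neg_zero, show h - 1 - 1 = h - 2 by omega] at hpred
    rw [hder, coeff_C_mul, hpred, mul_zero, show h - 2 + 1 = h - 1 by omega] at hcoeff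
    exact (mul_eq_zero.1 hcoeff.symm).resolve_right (Nat.cast_add_one_ne_zero _)
  · have hsep := separable_prod_X_sub_C_iff.2 hr
    rw [hder, derivative_C_mul, eval_mul, eval_C]
    refine mul_ne_zero hc ?_
    have := hsep.aeval_derivative_ne_zero (x := r j)
      (by simp [Finset.prod_eq_zero_iff, sub_eq_zero])
    simpa using this
end

section
/- Let N ≥ 3 and h ≥ N. Let ī = (i_1,…,i_{N−1}) and j̄ = (j_1,…,j_{N−1}) be tuples of integers with 1 ≤ i_{N−1} < … < i_1 ≤ h−1 and 1 ≤ j_{N−1} < … < j_1 ≤ h−1 (i.e. ī, j̄ ∈ Q_{N,k} with h = N+k), and let σ be a permutation of {1,…,N−1} with σ ≠ id. Then it is NOT the case that j_{σ(n)} − i_n ∈ {0,1} for all n = 1,…,N−1, and it is NOT the case that j_{σ(n)} − i_n ∈ {−1,0} for all n = 1,…,N−1. -/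
/-- A strictly monotone permutation of a well-order is the identity. -/
theorem Equiv.Perm.eq_one_of_strictMono {α : Type*} [LinearOrder α] [WellFoundedLT α]
    {σ : Equiv.Perm α}
    (h : StrictMono σ) : σ = 1 :=
  Equiv.coe_fn_injective <| (h.range_inj strictMono_id).mp <| by
    rw [σ.surjective.range_eq, Set.range_id]

/-- If two strictly decreasing families, one of them rearranged by `σ`, have all their
differences in `{c, c + 1}`, then `σ` is the identity. -/
theorem Equiv.Perm.eq_one_of_strictAnti_of_sub_mem {α : Type*} [LinearOrder α]
    [WellFoundedLT α] {a b : α → ℤ}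
    (ha : StrictAnti a) (hb : StrictAnti b) {σ : Equiv.Perm α} (c : ℤ)
    (h : ∀ k, b (σ k) - a k ∈ ({c, c + 1} : Set ℤ)) : σ = 1 := by
  refine Equiv.Perm.eq_one_of_strictMono fun m k hmk => hb.lt_iff_gt.mp ?_
  have hne : b (σ k) ≠ b (σ m) := fun e => hmk.ne' (σ.injective (hb.injective e))
  have hak := ha hmk
  have hm := h m
  have hk := h k
  simp only [Set.mem_insert_iff, Set.mem_singleton_iff] at hm hk
  omega

/-- used in the proof of Theorem 3: `(Δ_ī, σΔ_j̄) = 0` for `σ ≠ 1`: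
let `ī = (i₁,…,i_{N-1})` and `j̄ = (j₁,…,j_{N-1})` be strictly decreasing tuples of
integers in `[1, h-1]` (elements of `Q_{N,k}`, `h = N+k`), and let `σ ≠ id` be a
permutation of `{1,…,N-1}`. Then neither do all the differences `j_{σ(n)} - i_n`
lie in `{0,1}`, nor do they all lie in `{-1,0}`. -/
theorem stmt17 (N h : ℕ) (hN : 3 ≤ N) (hh : N ≤ h)
    (i j : Fin (N - 1) → ℕ)
    (hi : (∀ m n : Fin (N - 1), m < n → i n < i m) ∧ ∀ n, 1 ≤ i n ∧ i n ≤ h - 1)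
    (hj : (∀ m n : Fin (N - 1), m < n → j n < j m) ∧ ∀ n, 1 ≤ j n ∧ j n ≤ h - 1)
    (σ : Equiv.Perm (Fin (N - 1))) (hσ : σ ≠ 1) :
    ¬ (∀ n, ((j (σ n) : ℤ) - (i n : ℤ)) ∈ ({0, 1} : Set ℤ)) ∧
    ¬ (∀ n, ((j (σ n) : ℤ) - (i n : ℤ)) ∈ ({-1, 0} : Set ℤ)) := by
  have ha : StrictAnti fun n => (i n : ℤ) := fun m n hmn => Int.ofNat_lt.mpr (hi.1 m n hmn)
  have hb : StrictAnti fun n => (j n : ℤ) := fun m n hmn => Int.ofNat_lt.mpr (hj.1 m n hmn)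
  exact ⟨fun H => hσ (Equiv.Perm.eq_one_of_strictAnti_of_sub_mem ha hb 0 H),
    fun H => hσ (Equiv.Perm.eq_one_of_strictAnti_of_sub_mem ha hb (-1) H)⟩
end
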